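/- O(1/n²) convergence of the fast pre-relaxed block Jacobi method (distance form): let p⁽⁰⁾ = q⁽⁰⁾ ∈ C and t₀ = 1, and for each n define p⁽ⁿ⁺¹⁾ = Σ_{k=1}^{N_c} R_k* t_k⁽ⁿ⁾ where t_k⁽ⁿ⁾ ∈ C_k is any minimizer of p_k ↦ F_k(N_c p_k − (N_c − 1) R_k q⁽ⁿ⁾; q⁽ⁿ⁾) over C_k, t_{n+1} = (1 + √(1 + 4t_n²))/2, and q⁽ⁿ⁺¹⁾ = p⁽ⁿ⁺¹⁾ + ((t_n − 1)/t_{n+1})(p⁽ⁿ⁺¹⁾ − p⁽ⁿ⁾). Let p* be a minimizer of F over C. Then for any n ≥ 1, F(p⁽ⁿ⁾) − F(p*) ≤ 4 N_c · D(p*, p⁽⁰⁾) / (n + 1)². -/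

import Mathlib

open Finset

noncomputable section

/-- The discrete image domain of `M × N` pixels. -/
abbrev Idx (M N : ℕ) := Fin M × Fin N

/-- The discrete divergence operator `div : W → V`, the negative adjoint of
the discrete gradient. -/
def divOp {M N : ℕ} (p : Idx M N → ℝ × ℝ) : Idx M N → ℝ := fun x =>
  ((if (x.1 : ℕ) + 1 < M then (p x).1 else 0)
    - (if 1 ≤ (x.1 : ℕ) then
        (p (⟨(x.1 : ℕ) - 1, lt_of_le_of_lt (Nat.sub_le _ _) x.1.isLt⟩, x.2)).1 else 0))
  + ((if (x.2 : ℕ) + 1 < N then (p x).2 else 0)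
    - (if 1 ≤ (x.2 : ℕ) then
        (p (x.1, ⟨(x.2 : ℕ) - 1, lt_of_le_of_lt (Nat.sub_le _ _) x.2.isLt⟩)).2 else 0))

/-- The discrete gradient operator `∇ : V → W`. -/
def gradOp {M N : ℕ} (u : Idx M N → ℝ) : Idx M N → ℝ × ℝ := fun x =>
  ((if h : (x.1 : ℕ) + 1 < M then u (⟨(x.1 : ℕ) + 1, h⟩, x.2) - u x else 0),
   (if h : (x.2 : ℕ) + 1 < N then u (x.1, ⟨(x.2 : ℕ) + 1, h⟩) - u x else 0))

/-- Euclidean inner product on `V`. -/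
def innerV {M N : ℕ} (u v : Idx M N → ℝ) : ℝ := ∑ x, u x * v x

/-- Euclidean inner product on `W`. -/
def innerW {M N : ℕ} (p q : Idx M N → ℝ × ℝ) : ℝ :=
  ∑ x, ((p x).1 * (q x).1 + (p x).2 * (q x).2)

/-- Squared Euclidean norm on `V`. -/
def normVsq {M N : ℕ} (u : Idx M N → ℝ) : ℝ := ∑ x, (u x) ^ 2

/-- Max (Euclidean-pointwise) norm on `W`. -/
def normWinf {M N : ℕ} (p : Idx M N → ℝ × ℝ) : ℝ :=
  ⨆ x : Idx M N, Real.sqrt ((p x).1 ^ 2 + (p x).2 ^ 2)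

/-- The dual ROF energy `F(p) = (1/2)‖div p + α f‖₂²`. -/
def F {M N : ℕ} (α : ℝ) (f : Idx M N → ℝ) (p : Idx M N → ℝ × ℝ) : ℝ :=
  (1 / 2) * normVsq (fun x => divOp p x + α * f x)

/-- The gradient of `F`, namely `∇F(q) = div*(div q + α f) = -∇(div q + α f)`. -/
def gradF {M N : ℕ} (α : ℝ) (f : Idx M N → ℝ) (q : Idx M N → ℝ × ℝ) :
    Idx M N → ℝ × ℝ :=
  fun x => - gradOp (fun y => divOp q y + α * f y) x

/-- The constraint set `C = {p ∈ W : |p_{ij}| ≤ 1 ∀ (i,j)}`. -/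
def Cset (M N : ℕ) : Set (Idx M N → ℝ × ℝ) :=
  {p | ∀ x, Real.sqrt ((p x).1 ^ 2 + (p x).2 ^ 2) ≤ 1}

/-- Restriction operator `R_k : W → W_k`. -/
def Rk {M N : ℕ} (S : Finset (Idx M N)) (p : Idx M N → ℝ × ℝ) :
    {x // x ∈ S} → ℝ × ℝ :=
  fun x => p x.1

/-- Extension-by-zero operator `R_k* : W_k → W`. -/
def Ek {M N : ℕ} (S : Finset (Idx M N)) (pk : {x // x ∈ S} → ℝ × ℝ) :
    Idx M N → ℝ × ℝ :=
  fun x => if h : x ∈ S then pk ⟨x, h⟩ else 0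

/-- The orthogonal projection `R_k* R_k : W → W`. -/
def projk {M N : ℕ} (S : Finset (Idx M N)) (p : Idx M N → ℝ × ℝ) :
    Idx M N → ℝ × ℝ :=
  fun x => if x ∈ S then p x else 0

/-- The local constraint set `C_k = R_k C`. -/
def Ck {M N : ℕ} (S : Finset (Idx M N)) : Set ({x // x ∈ S} → ℝ × ℝ) :=
  Rk S '' Cset M N

/-- The local energy `F_k(p_k; r) = F(R_k* p_k + (I - R_k* R_k) r)`. -/
def Fk {M N : ℕ} (α : ℝ) (f : Idx M N → ℝ) (S : Finset (Idx M N))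
    (pk : {x // x ∈ S} → ℝ × ℝ) (r : Idx M N → ℝ × ℝ) : ℝ :=
  F α f (Ek S pk + (r - projk S r))

/-- Euclidean inner product on `W_k`. -/
def innerWk {M N : ℕ} (S : Finset (Idx M N)) (pk qk : {x // x ∈ S} → ℝ × ℝ) : ℝ :=
  ∑ x : {x // x ∈ S}, ((pk x).1 * (qk x).1 + (pk x).2 * (qk x).2)

/-- The distance-like quantity `D(p,q) = Σ_k (1/2)‖div R_k* R_k (p - q)‖₂²`. -/
def Ddist {M N Nc : ℕ} (S : Fin Nc → Finset (Idx M N))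
    (p q : Idx M N → ℝ × ℝ) : ℝ :=
  ∑ k, (1 / 2) * normVsq (divOp (projk (S k) (p - q)))

/-- The rectangular subdomain `Ω_s` of size `m × n` indexed by `s : Fin Ms × Fin Ns`
(for an `M × N` image with `M = Ms * m`, `N = Ns * n`). -/
def block {M N Ms Ns : ℕ} (m n : ℕ) (s : Fin Ms × Fin Ns) : Finset (Idx M N) :=
  Finset.univ.filter fun x => (x.1 : ℕ) / m = (s.1 : ℕ) ∧ (x.2 : ℕ) / n = (s.2 : ℕ)

end

section AcceleratedJacobi

variable {W V : Type*} [AddCommGroup W] [Module ℝ W]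
  [NormedAddCommGroup V] [InnerProductSpace ℝ V]

/-- Variational inequality for a minimizer of a least-squares functional over a convex set. -/
theorem Convex.inner_nonneg_of_forall_norm_sq_le {C : Set W} (hC : Convex ℝ C) {a : V}
    {B : W →ₗ[ℝ] V} {c : ℝ} {y x q : W} (hy : y ∈ C) (hx : x ∈ C)
    (hmin : ∀ r ∈ C, ‖a + c • B (y - q)‖ ^ 2 ≤ ‖a + c • B (r - q)‖ ^ 2) :
    0 ≤ inner ℝ (a + c • B (y - q)) (c • B (x - y)) := by
  have key : ∀ s ∈ Set.Ioc (0 : ℝ) 1,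
      0 ≤ 2 * inner ℝ (a + c • B (y - q)) (c • B (x - y)) + s * ‖c • B (x - y)‖ ^ 2 := by
    rintro s ⟨hs0, hs1⟩
    have h := hmin _ (hC.add_smul_sub_mem hy hx ⟨hs0.le, hs1⟩)
    have e : a + c • B (y + s • (x - y) - q)
        = (a + c • B (y - q)) + s • (c • B (x - y)) := by
      rw [add_sub_right_comm, map_add, map_smul]; module
    rw [e, norm_add_sq_real (a + c • B (y - q)), inner_smul_right, norm_smul s, mul_pow,
      Real.norm_eq_abs, sq_abs] at h
    have h' : 0 ≤ s * (2 * inner ℝ (a + c • B (y - q)) (c • B (x - y))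
        + s * ‖c • B (x - y)‖ ^ 2) := by linarith
    exact nonneg_of_mul_nonneg_right h' hs0
  by_contra! hneg
  set u := inner ℝ (a + c • B (y - q)) (c • B (x - y))
  set w := ‖c • B (x - y)‖ ^ 2
  have hw : 0 ≤ w := by positivity
  have hden : 0 < w - u := by linarith
  have h := key (-u / (w - u)) ⟨div_pos (by linarith) hden, (div_le_one hden).2 (by linarith)⟩
  have hb : -u / (w - u) * w ≤ -u := by
    rw [div_mul_eq_mul_div, div_le_iff₀ hden]
    nlinarith
  linarith

variable {m : ℕ}

/-- The least-squares energy `½‖∑ₖ Aₖ p + b‖²`. -/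
noncomputable def leastSquares (A : Fin m → W →ₗ[ℝ] V) (b : V) (p : W) : ℝ :=
  1 / 2 * ‖∑ k, A k p + b‖ ^ 2

/-- The block-separable quadratic form `∑ₖ ½‖Aₖ p‖²`. -/
noncomputable def blockForm (A : Fin m → W →ₗ[ℝ] V) (p : W) : ℝ :=
  ∑ k, 1 / 2 * ‖A k p‖ ^ 2

theorem blockForm_nonneg (A : Fin m → W →ₗ[ℝ] V) (p : W) : 0 ≤ blockForm A p :=
  Finset.sum_nonneg fun _ _ => by positivity

theorem blockForm_smul (A : Fin m → W →ₗ[ℝ] V) (c : ℝ) (p : W) :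
    blockForm A (c • p) = c ^ 2 * blockForm A p := by
  simp only [blockForm, map_smul, norm_smul, mul_pow, Real.norm_eq_abs, sq_abs, Finset.mul_sum]
  exact Finset.sum_congr rfl fun _ _ => by ring

theorem convexOn_leastSquares (A : Fin m → W →ₗ[ℝ] V) (b : V) :
    ConvexOn ℝ Set.univ (leastSquares A b) := by
  refine ⟨convex_univ, fun x _ y _ s r hs hr hsr => ?_⟩
  have e : ∑ k, A k (s • x + r • y) + b = s • (∑ k, A k x + b) + r • (∑ k, A k y + b) := by
    have hb : b = s • b + r • b := by rw [← add_smul, hsr, one_smul]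
    simp only [map_add, map_smul, Finset.sum_add_distrib, ← Finset.smul_sum]
    nth_rewrite 1 [hb]
    module
  have h := ((convexOn_norm (convex_univ (𝕜 := ℝ) (E := V))).pow
    (fun _ _ => norm_nonneg _) 2).2 (Set.mem_univ (∑ k, A k x + b))
    (Set.mem_univ (∑ k, A k y + b)) hs hr hsr
  simp only [Pi.pow_apply, smul_eq_mul] at h
  simp only [leastSquares, e, smul_eq_mul]
  linarith

/-- Descent estimate for one pre-relaxed block Jacobi step from `q` to `y`. -/
theorem leastSquares_le_of_forall_block_min {C : Set W} (hC : Convex ℝ C)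
    (A : Fin m → W →ₗ[ℝ] V) (b : V) {q y x : W} (hy : y ∈ C) (hx : x ∈ C)
    (hmin : ∀ k, ∀ r ∈ C, ‖(∑ j, A j q + b) + (m : ℝ) • A k (y - q)‖ ^ 2
      ≤ ‖(∑ j, A j q + b) + (m : ℝ) • A k (r - q)‖ ^ 2) :
    leastSquares A b y ≤ leastSquares A b x
      + m * (blockForm A (x - q) - blockForm A (x - y)) := by
  set a := ∑ j, A j q + b with ha
  have expand : ∀ z, ∑ k, A k z + b = a + ∑ k, A k (z - q) := by
    intro z
    simp only [ha, map_sub, Finset.sum_sub_distrib]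
    abel
  have hvar : 0 ≤ inner ℝ a (∑ k, A k (x - y))
      + m * ∑ k, inner ℝ (A k (y - q)) (A k (x - y)) := by
    rw [inner_sum, Finset.mul_sum, ← Finset.sum_add_distrib]
    refine Finset.sum_nonneg fun k _ => ?_
    have hm : (0 : ℝ) < m := by exact_mod_cast k.pos
    have h := hC.inner_nonneg_of_forall_norm_sq_le hy hx (hmin k)
    rw [inner_smul_right, inner_add_left, real_inner_smul_left] at h
    exact nonneg_of_mul_nonneg_right h hm
  have hupper : ‖∑ k, A k (y - q)‖ ^ 2 ≤ m * ∑ k, ‖A k (y - q)‖ ^ 2 := by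
    have h := sq_sum_le_card_mul_sum_sq (s := (Finset.univ : Finset (Fin m)))
      (f := fun k => ‖A k (y - q)‖)
    rw [Finset.card_univ, Fintype.card_fin] at h
    exact (pow_le_pow_left₀ (norm_nonneg _) (norm_sum_le _ _) 2).trans h
  have hform : blockForm A (x - q) - blockForm A (x - y)
      = 1 / 2 * ∑ k, ‖A k (y - q)‖ ^ 2 + ∑ k, inner ℝ (A k (y - q)) (A k (x - y)) := by
    simp only [blockForm, Finset.mul_sum]
    rw [← Finset.sum_sub_distrib, ← Finset.sum_add_distrib]
    refine Finset.sum_congr rfl fun k _ => ?_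
    rw [← sub_add_sub_cancel' y q x, map_add, norm_add_sq_real]
    ring
  have hsplit : inner ℝ a (∑ k, A k (x - q))
      = inner ℝ a (∑ k, A k (y - q)) + inner ℝ a (∑ k, A k (x - y)) := by
    rw [← inner_add_right, ← Finset.sum_add_distrib]
    simp only [← map_add, sub_add_sub_cancel']
  rw [hform]
  simp only [leastSquares, expand, norm_add_sq_real, hsplit]
  nlinarith [sq_nonneg ‖∑ k, A k (x - q)‖]

/-- The `O(1/n²)` rate of the momentum-accelerated pre-relaxed block Jacobi iteration for a
least-squares energy over a convex set. -/
theorem leastSquares_accelerated_rate {C : Set W} (hC : Convex ℝ C)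
    (A : Fin m → W →ₗ[ℝ] V) (b : V) {p q : ℕ → W} {ts : ℕ → ℝ}
    (hp : ∀ n, p n ∈ C) (hq0 : q 0 = p 0) (ht0 : ts 0 = 1)
    (hmin : ∀ n k, ∀ r ∈ C, ‖(∑ j, A j (q n) + b) + (m : ℝ) • A k (p (n + 1) - q n)‖ ^ 2
      ≤ ‖(∑ j, A j (q n) + b) + (m : ℝ) • A k (r - q n)‖ ^ 2)
    (hts : ∀ n, ts (n + 1) = (1 + Real.sqrt (1 + 4 * ts n ^ 2)) / 2)
    (hq : ∀ n, q (n + 1) = p (n + 1) + ((ts n - 1) / ts (n + 1)) • (p (n + 1) - p n))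
    {z : W} (hz : z ∈ C) (hzmin : ∀ r ∈ C, leastSquares A b z ≤ leastSquares A b r)
    {n : ℕ} (hn : 1 ≤ n) :
    leastSquares A b (p n) - leastSquares A b z
      ≤ 4 * m * blockForm A (z - p 0) / ((n : ℝ) + 1) ^ 2 := by
  have hlow : ∀ n : ℕ, ((n : ℝ) + 2) / 2 ≤ ts n := by
    intro n
    induction n with
    | zero => simp [ht0]
    | succ n ih =>
      have h : 2 * ts n ≤ Real.sqrt (1 + 4 * ts n ^ 2) :=
        Real.le_sqrt_of_sq_le (by nlinarith)
      rw [hts]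
      push_cast
      linarith
  have hone : ∀ n, 1 ≤ ts n := fun n => by
    have := hlow n
    have : (0 : ℝ) ≤ n := n.cast_nonneg
    linarith
  have hsq : ∀ n, ts (n + 1) ^ 2 - ts (n + 1) = ts n ^ 2 := fun n => by
    have h := Real.sq_sqrt (show 0 ≤ 1 + 4 * ts n ^ 2 by positivity)
    rw [hts]
    linarith
  have hstep : ∀ n, ts n ^ 2 * (leastSquares A b (p (n + 1)) - leastSquares A b z)
      + m * blockForm A (z - (ts n • p (n + 1) - (ts n - 1) • p n))
      ≤ (ts n ^ 2 - ts n) * (leastSquares A b (p n) - leastSquares A b z)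
      + m * blockForm A (z - (ts n • q n - (ts n - 1) • p n)) := by
    intro n
    have ht := hone n
    have htpos : 0 < ts n := by linarith
    have hw₁ : 0 ≤ 1 - (ts n)⁻¹ := sub_nonneg.2 (inv_le_one_of_one_le₀ ht)
    have hw₂ : 0 ≤ (ts n)⁻¹ := by positivity
    have hw : 1 - (ts n)⁻¹ + (ts n)⁻¹ = 1 := by ring
    set x := (1 - (ts n)⁻¹) • p n + (ts n)⁻¹ • z with hx
    have hxs : ts n • x = (ts n - 1) • p n + z := by
      rw [hx, smul_add, smul_smul, smul_smul, mul_sub, mul_inv_cancel₀ htpos.ne', mul_one,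
        one_smul]
    have hdesc := leastSquares_le_of_forall_block_min hC A b (hp (n + 1))
      (hC (hp n) hz hw₁ hw₂ hw) (hmin n)
    have hconv := (convexOn_leastSquares A b).2 (Set.mem_univ (p n)) (Set.mem_univ z) hw₁ hw₂ hw
    rw [← hx] at hdesc hconv
    simp only [smul_eq_mul] at hconv
    have hform : ∀ y, blockForm A (z - (ts n • y - (ts n - 1) • p n))
        = ts n ^ 2 * blockForm A (x - y) := by
      intro y
      rw [← blockForm_smul, smul_sub, hxs]
      congr 1
      abel
    rw [hform, hform]
    have h := mul_le_mul_of_nonneg_left (hdesc.trans (add_le_add_left hconv _))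
      (sq_nonneg (ts n))
    have hinv : ts n ^ 2 * (ts n)⁻¹ = ts n := by field_simp
    linear_combination h + (leastSquares A b z - leastSquares A b (p n)) * hinv
  have hmom : ∀ n, ts (n + 1) • q (n + 1) - (ts (n + 1) - 1) • p (n + 1)
      = ts n • p (n + 1) - (ts n - 1) • p n := by
    intro n
    have h : ts (n + 1) ≠ 0 := by linarith [hone (n + 1)]
    rw [hq, smul_add, smul_smul, mul_div_cancel₀ _ h]
    module
  have hpot : ∀ n, ts n ^ 2 * (leastSquares A b (p (n + 1)) - leastSquares A b z)
      + m * blockForm A (z - (ts n • p (n + 1) - (ts n - 1) • p n))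
      ≤ m * blockForm A (z - p 0) := by
    intro n
    induction n with
    | zero => simpa [ht0, hq0] using hstep 0
    | succ n ih =>
      have h := hstep (n + 1)
      rw [hsq, hmom] at h
      exact h.trans ih
  obtain ⟨n, rfl⟩ := Nat.exists_eq_add_of_le' hn
  have hgap := sub_nonneg.2 (hzmin _ (hp (n + 1)))
  have hrem : 0 ≤ m * blockForm A (z - (ts n • p (n + 1) - (ts n - 1) • p n)) :=
    mul_nonneg m.cast_nonneg (blockForm_nonneg _ _)
  have hts2 : (((n : ℝ) + 2) / 2) ^ 2 ≤ ts n ^ 2 := pow_le_pow_left₀ (by positivity) (hlow n) 2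
  rw [le_div_iff₀ (by positivity)]
  push_cast
  linarith [hpot n, mul_le_mul_of_nonneg_right hts2 hgap]

end AcceleratedJacobi

section DiscreteImages

variable {M N : ℕ}

theorem divOp_add (p q : Idx M N → ℝ × ℝ) : divOp (p + q) = divOp p + divOp q := by
  funext x
  simp only [divOp, Pi.add_apply, Prod.fst_add, Prod.snd_add]
  split_ifs <;> ring

theorem divOp_smul (c : ℝ) (p : Idx M N → ℝ × ℝ) : divOp (c • p) = c • divOp p := by
  funext x
  simp only [divOp, Pi.smul_apply, Prod.smul_fst, Prod.smul_snd, smul_eq_mul]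
  split_ifs <;> ring

theorem projk_add (S : Finset (Idx M N)) (p q : Idx M N → ℝ × ℝ) :
    projk S (p + q) = projk S p + projk S q := by
  funext x
  by_cases h : x ∈ S <;> simp [projk, h]

theorem projk_smul (S : Finset (Idx M N)) (c : ℝ) (p : Idx M N → ℝ × ℝ) :
    projk S (c • p) = c • projk S p := by
  funext x
  by_cases h : x ∈ S <;> simp [projk, h]

/-- The divergence as a linear map into the Euclidean space of images. -/
noncomputable def divLin (M N : ℕ) : (Idx M N → ℝ × ℝ) →ₗ[ℝ] EuclideanSpace ℝ (Idx M N) where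
  toFun p := WithLp.toLp 2 (divOp p)
  map_add' p q := by rw [divOp_add, WithLp.toLp_add]
  map_smul' c p := by rw [divOp_smul, WithLp.toLp_smul, RingHom.id_apply]

/-- The operator `div R_k* R_k` as a linear map into the Euclidean space of images. -/
noncomputable def blockDiv (S : Finset (Idx M N)) :
    (Idx M N → ℝ × ℝ) →ₗ[ℝ] EuclideanSpace ℝ (Idx M N) :=
  divLin M N ∘ₗ
    { toFun := projk S
      map_add' := projk_add S
      map_smul' := projk_smul S }

theorem blockDiv_apply (S : Finset (Idx M N)) (p : Idx M N → ℝ × ℝ) :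
    blockDiv S p = divLin M N (projk S p) := rfl

theorem normVsq_eq_norm_sq (u : Idx M N → ℝ) :
    normVsq u = ‖(WithLp.toLp 2 u : EuclideanSpace ℝ (Idx M N))‖ ^ 2 := by
  simp [normVsq, EuclideanSpace.norm_sq_eq]

theorem F_eq_norm_sq (α : ℝ) (f : Idx M N → ℝ) (p : Idx M N → ℝ × ℝ) :
    F α f p = 1 / 2 * ‖divLin M N p + WithLp.toLp 2 (α • f)‖ ^ 2 := by
  rw [F, normVsq_eq_norm_sq]
  rfl

theorem sum_Ek_apply {Nc : ℕ} {S : Fin Nc → Finset (Idx M N)}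
    (hdisj : ∀ k l, k ≠ l → Disjoint (S k) (S l))
    (t : ∀ k, {x // x ∈ S k} → ℝ × ℝ) {k : Fin Nc} {x : Idx M N} (hx : x ∈ S k) :
    (∑ l, Ek (S l) (t l)) x = t k ⟨x, hx⟩ := by
  rw [Finset.sum_apply, Finset.sum_eq_single k]
  · simp [Ek, hx]
  · intro l _ hl
    exact dif_neg fun h => Finset.disjoint_left.1 (hdisj l k hl) h hx
  · simp

theorem sum_projk {Nc : ℕ} {S : Fin Nc → Finset (Idx M N)}
    (hdisj : ∀ k l, k ≠ l → Disjoint (S k) (S l)) (hcover : ∀ x : Idx M N, ∃ k, x ∈ S k)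
    (p : Idx M N → ℝ × ℝ) : ∑ k, projk (S k) p = p := by
  funext x
  obtain ⟨k, hk⟩ := hcover x
  exact sum_Ek_apply hdisj (fun l => Rk (S l) p) hk

theorem sum_blockDiv {Nc : ℕ} {S : Fin Nc → Finset (Idx M N)}
    (hdisj : ∀ k l, k ≠ l → Disjoint (S k) (S l)) (hcover : ∀ x : Idx M N, ∃ k, x ∈ S k)
    (p : Idx M N → ℝ × ℝ) : ∑ k, blockDiv (S k) p = divLin M N p := by
  simp only [blockDiv_apply]
  rw [← map_sum, sum_projk hdisj hcover]

theorem Ddist_eq_blockForm {Nc : ℕ} (S : Fin Nc → Finset (Idx M N)) (p q : Idx M N → ℝ × ℝ) :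
    Ddist S p q = blockForm (fun k => blockDiv (S k)) (p - q) := by
  simp only [Ddist, normVsq_eq_norm_sq]
  rfl

theorem Fk_prerelaxed (α : ℝ) (f : Idx M N → ℝ) (S : Finset (Idx M N)) (c : ℝ)
    (r q : Idx M N → ℝ × ℝ) :
    Fk α f S (c • Rk S r - (c - 1) • Rk S q) q
      = 1 / 2 * ‖(divLin M N q + WithLp.toLp 2 (α • f)) + c • blockDiv S (r - q)‖ ^ 2 := by
  have e : Ek S (c • Rk S r - (c - 1) • Rk S q) + (q - projk S q)
      = q + c • projk S (r - q) := by
    funext x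
    by_cases h : x ∈ S
    · simp only [Ek, Rk, projk, Pi.add_apply, Pi.sub_apply, Pi.smul_apply, h, dite_true, if_true]
      module
    · simp [Ek, projk, h]
  rw [Fk, e, F_eq_norm_sq, map_add, map_smul, blockDiv_apply, add_right_comm]

theorem convex_Cset (M N : ℕ) : Convex ℝ (Cset M N) := by
  intro p hp q hq a b ha hb hab x
  have hp' := (Real.sqrt_le_one).1 (hp x)
  have hq' := (Real.sqrt_le_one).1 (hq x)
  refine Real.sqrt_le_one.2 ?_
  simp only [Pi.add_apply, Pi.smul_apply, Prod.fst_add, Prod.snd_add, Prod.smul_fst,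
    Prod.smul_snd, smul_eq_mul]
  obtain rfl : b = 1 - a := by linarith
  nlinarith [mul_nonneg (mul_nonneg ha hb) (sq_nonneg ((p x).1 - (q x).1)),
    mul_nonneg (mul_nonneg ha hb) (sq_nonneg ((p x).2 - (q x).2)),
    mul_le_mul_of_nonneg_left hp' ha, mul_le_mul_of_nonneg_left hq' hb]

end DiscreteImages

theorem fast_prerelaxed_jacobi_rate (M N : ℕ) (α : ℝ) (hα : 0 < α) (f : Idx M N → ℝ)
    (Nc : ℕ) (S : Fin Nc → Finset (Idx M N))
    (hdisj : ∀ k l, k ≠ l → Disjoint (S k) (S l))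
    (hcover : ∀ x : Idx M N, ∃ k, x ∈ S k)
    (p q : ℕ → Idx M N → ℝ × ℝ) (ts : ℕ → ℝ)
    (hp0 : p 0 ∈ Cset M N) (hq0 : q 0 = p 0) (ht0 : ts 0 = 1)
    (t : ∀ _ : ℕ, ∀ k : Fin Nc, {x // x ∈ S k} → ℝ × ℝ)
    (ht : ∀ n k, t n k ∈ Ck (S k))
    (hmin : ∀ n k, ∀ rk ∈ Ck (S k),
      Fk α f (S k) ((Nc : ℝ) • t n k - ((Nc : ℝ) - 1) • Rk (S k) (q n)) (q n)
        ≤ Fk α f (S k) ((Nc : ℝ) • rk - ((Nc : ℝ) - 1) • Rk (S k) (q n)) (q n))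
    (hrec : ∀ n, p (n + 1) = ∑ k, Ek (S k) (t n k))
    (hts : ∀ n, ts (n + 1) = (1 + Real.sqrt (1 + 4 * ts n ^ 2)) / 2)
    (hqrec : ∀ n, q (n + 1) = p (n + 1) + ((ts n - 1) / ts (n + 1)) • (p (n + 1) - p n))
    (pstar : Idx M N → ℝ × ℝ) (hpstar : pstar ∈ Cset M N)
    (hstar : ∀ r ∈ Cset M N, F α f pstar ≤ F α f r)
    : ∀ n : ℕ, 1 ≤ n →
      F α f (p n) - F α f pstar ≤
        4 * (Nc : ℝ) * Ddist S pstar (p 0) / ((n : ℝ) + 1) ^ 2 := by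
  intro n hn
  have hRk : ∀ n k, Rk (S k) (p (n + 1)) = t n k := by
    intro n k
    funext x
    rw [Rk, hrec, sum_Ek_apply hdisj (t n) x.2]
  have hp : ∀ n, p n ∈ Cset M N := by
    rintro (_ | n)
    · exact hp0
    · intro x
      obtain ⟨k, hk⟩ := hcover x
      obtain ⟨r, hr, hrt⟩ := ht n k
      have hx : p (n + 1) x = r x := congrFun ((hRk n k).trans hrt.symm) ⟨x, hk⟩
      rw [hx]
      exact hr x
  have hF : F α f = leastSquares (fun k => blockDiv (S k)) (WithLp.toLp 2 (α • f)) := by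
    funext r
    rw [F_eq_norm_sq, leastSquares, sum_blockDiv hdisj hcover]
  rw [hF] at hstar ⊢
  rw [Ddist_eq_blockForm]
  refine leastSquares_accelerated_rate (convex_Cset M N) _ _ hp hq0 ht0 ?_ hts hqrec hpstar
    hstar hn
  intro n k r hr
  have h := hmin n k (Rk (S k) r) ⟨r, hr, rfl⟩
  rw [← hRk, Fk_prerelaxed, Fk_prerelaxed] at h
  rw [sum_blockDiv hdisj hcover]
  linarith
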